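/- Let m = 3, d = 2, β ≥ 0, with α_v^{ij} = −β for i ≠ j and α_v^{ii} = 0 (v ∈ {1,2}, i,j ∈ {1,2,3}), and let p = (1/2, 1/2, 1/2, 1/2, 1/2, 1/2). The characteristic polynomial of the Jacobian matrix JF(p) equals (1+λ)³ (−1 + β/2 − λ)² (1 + β + λ); in particular its eigenvalues, with multiplicity, are −1 (three times), −1 + β/2 (twice), and −1 − β. Consequently, p is linearly stable (all eigenvalues of JF(p) have negative real part) when β < 2, and p is linearly unstable (JF(p) has no eigenvalue with zero real part and some eigenvalue with positive real part) when β > 2. -/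

import Mathlib

open Polynomial

noncomputable def piMap (d m : ℕ) (α : Fin d → Fin m → Fin m → ℝ)
    (x : Fin m → Fin d → ℝ) : Fin m → Fin d → ℝ :=
  fun i v => Real.exp (∑ j, α v i j * x j v) / ∑ u, Real.exp (∑ j, α u i j * x j u)

noncomputable def FF (d m : ℕ) (α : Fin d → Fin m → Fin m → ℝ)
    (x : Fin m → Fin d → ℝ) : Fin m → Fin d → ℝ :=
  fun i v => -(x i v) + piMap d m α x i v

/-- The Jacobian matrix of `F` at `x`. -/
noncomputable def JF (d m : ℕ) (α : Fin d → Fin m → Fin m → ℝ)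
    (x : Fin m → Fin d → ℝ) : Matrix (Fin m × Fin d) (Fin m × Fin d) ℝ :=
  Matrix.of fun p q =>
    fderiv ℝ (fun y => FF d m α y p.1 p.2) x (Pi.single q.1 (Pi.single q.2 (1 : ℝ)))

/-- `α_v^{ij} = -β` for `i ≠ j` and `α_v^{ii} = 0`, for three walks on two vertices. -/
noncomputable def alphaRep (β : ℝ) : Fin 2 → Fin 3 → Fin 3 → ℝ :=
  fun _ i j => if i = j then 0 else -β

/-- The centre `p = (1/2, 1/2, 1/2, 1/2, 1/2, 1/2)`. -/
noncomputable def pCenter : Fin 3 → Fin 2 → ℝ := fun _ _ => 1 / 2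

/-- The coordinate `y ↦ y j v` is its own derivative. -/
theorem hasFDerivAt_coord {d m : ℕ} (x : Fin m → Fin d → ℝ) (j : Fin m) (v : Fin d) :
    HasFDerivAt (fun y : Fin m → Fin d → ℝ => y j v)
      ((ContinuousLinearMap.proj v : (Fin d → ℝ) →L[ℝ] ℝ) ∘L
        (ContinuousLinearMap.proj j : (Fin m → Fin d → ℝ) →L[ℝ] (Fin d → ℝ))) x :=
  ((ContinuousLinearMap.proj v : (Fin d → ℝ) →L[ℝ] ℝ) ∘L
    (ContinuousLinearMap.proj j : (Fin m → Fin d → ℝ) →L[ℝ] (Fin d → ℝ))).hasFDerivAt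

/-- `∂F_v^i/∂x_u^j = -δ_{ij} δ_{vu} + α_u^{ij} π_v^i (δ_{vu} - π_u^i)`. -/
theorem JF_apply {d m : ℕ} (α : Fin d → Fin m → Fin m → ℝ) (x : Fin m → Fin d → ℝ)
    (i j : Fin m) (v u : Fin d) :
    JF d m α x (i, v) (j, u) = -(if i = j ∧ v = u then 1 else 0) +
      α u i j * piMap d m α x i v * ((if v = u then 1 else 0) - piMap d m α x i u) := by
  have hS (w : Fin d) := HasFDerivAt.fun_sum (u := Finset.univ) fun k _ =>
    (hasFDerivAt_coord x k w).const_mul (α w i k)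
  have hZ := HasFDerivAt.fun_sum (u := Finset.univ) fun w _ => (hS w).exp
  have hpos : 0 < ∑ w, Real.exp (∑ k, α w i k * x k w) :=
    Finset.sum_pos (fun _ _ => Real.exp_pos _) ⟨v, Finset.mem_univ v⟩
  have h := (hasFDerivAt_coord x i v).neg.add ((hS v).exp.mul
    ((hasDerivAt_inv hpos.ne').comp_hasFDerivAt x hZ))
  have hF := h.congr_of_eventuallyEq (f₁ := fun y => FF d m α y i v)
    (.of_forall fun y => by simp [FF, piMap, div_eq_mul_inv])
  simp only [JF, Matrix.of_apply, hF.fderiv, piMap]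
  have hc (k : Fin m) (w : Fin d) :
      (Pi.single j (Pi.single u (1 : ℝ)) : Fin m → Fin d → ℝ) k w =
        if k = j then if w = u then 1 else 0 else 0 := by
    by_cases hk : k = j
    · subst hk; simp [Pi.single_apply]
    · simp [hk]
  simp [hc, ite_and]
  generalize ∑ w, Real.exp (∑ k, α w i k * x k w) = Z
  by_cases hvu : v = u
  · subst hvu
    simp
    ring
  · simp [hvu]
    ring

open scoped Kronecker in
theorem charpoly_JF_center (β : ℝ) :
    (JF 2 3 (alphaRep β) pCenter).charpoly
        = (X + 1) ^ 3 * (X + C (1 - β / 2)) ^ 2 * (X + C (1 + β)) := by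
  let Q : Matrix (Fin 3) (Fin 3) ℝ := !![1, 1, 1; 1, -1, 0; 1, 0, -1]
  let R : Matrix (Fin 2) (Fin 2) ℝ := !![1, 1; 1, -1]
  let D : Matrix (Fin 3 × Fin 2) (Fin 3 × Fin 2) ℝ :=
    Matrix.diagonal fun p => !![-1, -1 - β; -1, -1 + β / 2; -1, -1 + β / 2] p.1 p.2
  have hP : IsUnit (Q ⊗ₖ R) := by
    rw [Matrix.isUnit_iff_isUnit_det, Matrix.det_kronecker, isUnit_iff_ne_zero]
    simp [Q, R, Matrix.det_fin_three, Matrix.det_fin_two]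
    norm_num
  have hπ (i : Fin 3) (v : Fin 2) : piMap 2 3 (alphaRep β) pCenter i v = 1 / 2 := by
    simp only [piMap, alphaRep, Fin.sum_univ_two, pCenter]
    field_simp
    norm_num
  have hJP : JF 2 3 (alphaRep β) pCenter * (Q ⊗ₖ R) = (Q ⊗ₖ R) * D := by
    ext ⟨i, v⟩ ⟨j, u⟩
    simp only [Matrix.mul_apply, Fintype.sum_prod_type, JF_apply, hπ, D,
      Matrix.kroneckerMap_apply, Fin.sum_univ_two, Fin.sum_univ_three, alphaRep]
    fin_cases i <;> fin_cases v <;> fin_cases j <;> fin_cases u <;> simp [Q, R] <;> ring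
  obtain ⟨P, hP⟩ := hP
  rw [← hP] at hJP
  have hJ : JF 2 3 (alphaRep β) pCenter = P.val * D * P⁻¹.val := by
    rw [← hJP, mul_assoc, Units.mul_inv, mul_one]
  rw [hJ, Matrix.coe_units_inv, Matrix.charpoly_units_conj, Matrix.charpoly_diagonal]
  simp [Fintype.prod_prod_type, Fin.prod_univ_succ]
  ring

/-- At `p = (1/2,…,1/2)` the characteristic polynomial of `JF(p)` is
`(λ+1)³ (λ+1-β/2)² (λ+1+β)`; hence its eigenvalues with multiplicity are
`-1` (three times), `-1+β/2` (twice) and `-1-β`. Consequently `p` is linearly stable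
when `β < 2` and linearly unstable when `β > 2`. -/
theorem charpoly_and_stability_at_center (β : ℝ) (hβ : 0 ≤ β) :
    (JF 2 3 (alphaRep β) pCenter).charpoly
        = (X + 1) ^ 3 * (X + C (1 - β / 2)) ^ 2 * (X + C (1 + β)) ∧
    (((JF 2 3 (alphaRep β) pCenter).map (algebraMap ℝ ℂ)).charpoly.roots
        = ({-1, -1, -1, -1 + (β : ℂ) / 2, -1 + (β : ℂ) / 2, -1 - (β : ℂ)} : Multiset ℂ)) ∧
    (β < 2 →
      ∀ μ ∈ spectrum ℂ ((JF 2 3 (alphaRep β) pCenter).map (algebraMap ℝ ℂ)), μ.re < 0) ∧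
    (2 < β →
      (∀ μ ∈ spectrum ℂ ((JF 2 3 (alphaRep β) pCenter).map (algebraMap ℝ ℂ)), μ.re ≠ 0) ∧
      (∃ μ ∈ spectrum ℂ ((JF 2 3 (alphaRep β) pCenter).map (algebraMap ℝ ℂ)), 0 < μ.re)) := by
  have hc := charpoly_JF_center β
  have hr : ((JF 2 3 (alphaRep β) pCenter).map (algebraMap ℝ ℂ)).charpoly.roots
      = ({-1, -1, -1, -1 + (β : ℂ) / 2, -1 + (β : ℂ) / 2, -1 - (β : ℂ)} : Multiset ℂ) := by
    rw [Matrix.charpoly_map, hc, ← roots_multiset_prod_X_sub_C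
      ({-1, -1, -1, -1 + (β : ℂ) / 2, -1 + (β : ℂ) / 2, -1 - (β : ℂ)} : Multiset ℂ)]
    congr 1
    simp
    ring
  have hs (μ : ℂ) : μ ∈ spectrum ℂ ((JF 2 3 (alphaRep β) pCenter).map (algebraMap ℝ ℂ)) ↔
      μ = -1 ∨ μ = -1 + (β : ℂ) / 2 ∨ μ = -1 - (β : ℂ) := by
    rw [Matrix.mem_spectrum_iff_isRoot_charpoly, ← mem_roots (Matrix.charpoly_monic _).ne_zero, hr]
    simp
  have hre : (-1 + (β : ℂ) / 2).re = -1 + β / 2 := by simp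
  refine ⟨hc, hr, fun h μ hμ => ?_, fun h => ⟨fun μ hμ => ?_, _, (hs _).2 (.inr (.inl rfl)), ?_⟩⟩
  · rcases (hs μ).1 hμ with rfl | rfl | rfl
    · simp
    · rw [hre]; linarith
    · simp; linarith
  · rcases (hs μ).1 hμ with rfl | rfl | rfl
    · simp
    · rw [hre]; linarith
    · simp; linarith
  · rw [hre]; linarith
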